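/- Let S ⊆ T be finite nonempty sets of points in [0,1) and let h ∈ [0,1). Let succ_A(h) denote the unique element t of a finite nonempty set A ⊆ [0,1) minimizing the forward distance fract(t − h) over t ∈ A. If succ_T(h) ∈ S, then succ_S(h) = succ_T(h). (Monotonicity of ring consistent hashing: adding nodes to the ring cannot move a key from one existing node to another existing node.) -/

import Mathlib

/-- Monotonicity of ring consistent hashing: if `S ⊆ T` are finite nonempty sets
of node positions in `[0,1)`, `h ∈ [0,1)` is a key hash, `sT` is the successor
of `h` in `T` (the element of `T` minimizing the forward distance
`Int.fract (t - h)`), and `sT ∈ S`, then any successor `sS` of `h` in `S`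
equals `sT`. -/
theorem ring_consistent_hash_monotone
    (S T : Finset ℝ) (hST : S ⊆ T) (hS : S.Nonempty)
    (hT01 : ∀ t ∈ T, t ∈ Set.Ico (0 : ℝ) 1)
    (h : ℝ) (hh : h ∈ Set.Ico (0 : ℝ) 1)
    (sT : ℝ) (hsT : sT ∈ T)
    (hsTmin : ∀ t ∈ T, Int.fract (sT - h) ≤ Int.fract (t - h))
    (hsTS : sT ∈ S)
    (sS : ℝ) (hsS : sS ∈ S)
    (hsSmin : ∀ t ∈ S, Int.fract (sS - h) ≤ Int.fract (t - h)) :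
    sS = sT := by
  have e := le_antisymm (hsSmin sT hsTS) (hsTmin sS (hST hsS))
  obtain ⟨z, hz⟩ := Int.fract_eq_fract.mp e
  obtain ⟨a0, a1⟩ := hT01 sS (hST hsS)
  obtain ⟨b0, b1⟩ := hT01 sT hsT
  have h1 : (z : ℝ) < 1 := by linarith
  have h2 : (-1 : ℝ) < z := by linarith
  have h3 : z < 1 := by exact_mod_cast h1
  have h4 : -1 < z := by exact_mod_cast h2
  have h5 : z = 0 := by omega
  subst h5
  push_cast at hz
  linarith
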